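/- c_11 = c_12 = c_13 = c_14 = 945. -/

import Mathlib

/-- Number of nontrivial proper divisors of `n`: divisors `d` with `1 < d < n`. -/
def ntpd (n : ℕ) : ℕ := (n.divisors.filter (fun d => 1 < d ∧ d < n)).card

/-- `cseq m` is the smallest positive odd integer with at least `m` nontrivial
proper divisors (with `cseq 0 = 3` by convention). -/
noncomputable def cseq (m : ℕ) : ℕ := if m = 0 then 3 else sInf {n | Odd n ∧ 0 < n ∧ m ≤ ntpd n}

/-- The divisors `d` of an odd `n < 945` with `1 < d` and `d * d ≤ n`. -/
def smallDivs (n : ℕ) : List ℕ :=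
  [3, 5, 7, 9, 11, 13, 15, 17, 19, 21, 23, 25, 27, 29].filter
    (fun d => Nat.beq (n % d) 0 && Nat.ble (d * d) n)

theorem smallDivs_length : ∀ k < 472, (smallDivs (2 * k + 1)).length ≤ 5 := by
  decide +kernel

theorem mem_smallDivs {n d : ℕ} (hn : Odd n) (hlt : n < 945) (hd : d ∣ n) (h1 : 1 < d)
    (hsq : d * d ≤ n) : d ∈ smallDivs n := by
  have hodd : d % 2 = 1 := Nat.odd_iff.mp (Odd.of_dvd_nat hn hd)
  have h30 : d ≤ 30 := by nlinarith
  unfold smallDivs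
  rw [List.mem_filter]
  constructor
  · simp only [List.mem_cons, List.not_mem_nil, or_false]
    omega
  · rw [Bool.and_eq_true]
    exact ⟨Nat.beq_eq.mpr (Nat.mod_eq_zero_of_dvd hd), Nat.ble_eq.mpr hsq⟩

/-- Every nontrivial divisor is at most the square root of `n`, or is the codivisor of such. -/
theorem ntpd_small (k : ℕ) (hk : k < 472) : ntpd (2 * k + 1) < 11 := by
  have hlen := smallDivs_length k hk
  have hodd : Odd (2 * k + 1) := ⟨k, rfl⟩
  have hlt : 2 * k + 1 < 945 := by omega
  generalize 2 * k + 1 = n at *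
  have hsub : n.divisors.filter (fun d => 1 < d ∧ d < n) ⊆
      (smallDivs n).toFinset ∪ (smallDivs n).toFinset.image (fun d => n / d) := by
    intro d hd
    rw [Finset.mem_filter, Nat.mem_divisors] at hd
    obtain ⟨⟨hdvd, h0⟩, h1, h2⟩ := hd
    rw [Finset.mem_union, Finset.mem_image]
    by_cases hsq : d * d ≤ n
    · exact Or.inl (List.mem_toFinset.mpr (mem_smallDivs hodd hlt hdvd h1 hsq))
    · obtain ⟨e, he⟩ := hdvd
      have he1 : 1 < e := by
        by_contra h
        have : d * e ≤ d * 1 := Nat.mul_le_mul_left d (by omega)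
        omega
      have hed : e < d := by
        by_contra h
        have : d * d ≤ d * e := Nat.mul_le_mul_left d (by omega)
        omega
      have hee : e * e ≤ n := by
        rw [he]
        exact Nat.mul_le_mul_right e hed.le
      refine Or.inr ⟨e, List.mem_toFinset.mpr
        (mem_smallDivs hodd hlt ⟨d, by rw [he, mul_comm]⟩ he1 hee), ?_⟩
      show n / e = d
      rw [he]
      exact Nat.mul_div_cancel d (by omega)
  have hcard := Finset.card_le_card hsub
  have hunion := Finset.card_union_le (smallDivs n).toFinset
    ((smallDivs n).toFinset.image (fun d => n / d))
  have himage := Finset.card_image_le (s := (smallDivs n).toFinset) (f := fun d => n / d)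
  have htof := List.toFinset_card_le (smallDivs n)
  unfold ntpd
  omega

theorem ntpd_945 : ntpd 945 = 14 := by
  decide +kernel

theorem cseq_eq_of_mem {m : ℕ} (h1 : 11 ≤ m) (h2 : m ≤ 14) : cseq m = 945 := by
  unfold cseq
  rw [if_neg (by omega)]
  have hmem : 945 ∈ {n | Odd n ∧ 0 < n ∧ m ≤ ntpd n} :=
    ⟨by decide, by norm_num, by rw [ntpd_945]; exact h2⟩
  apply le_antisymm (Nat.sInf_le hmem)
  obtain ⟨⟨k, hk⟩, -, hn⟩ := Nat.sInf_mem ⟨_, hmem⟩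
  by_contra hlt
  have h := ntpd_small k (by omega)
  rw [← hk] at h
  omega

theorem cseq_eleven_to_fourteen :
    cseq 11 = 945 ∧ cseq 12 = 945 ∧ cseq 13 = 945 ∧ cseq 14 = 945 := by
  refine ⟨?_, ?_, ?_, ?_⟩ <;> exact cseq_eq_of_mem (by norm_num) (by norm_num)
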